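/- If α̃ is a smooth complex-valued function on Ω with 𝔗⁽⁺²⁾α̃ = 0, then on Ω: (𝓛⁽⁺²⁾(𝓛⁽⁺²⁾−2) − 12M∂ₜ)α̃ = w² (w⁻¹L)(w⁻¹L)(w⁻¹L̲)(w⁻¹L̲) α̃. If α̃ is a smooth complex-valued function on Ω with 𝔗⁽⁻²⁾α̃ = 0, then on Ω: (𝓛⁽⁻²⁾(𝓛⁽⁻²⁾−2) + 12M∂ₜ)α̃ = w² (w⁻¹L̲)(w⁻¹L̲)(w⁻¹L)(w⁻¹L) α̃. -/

import Mathlib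

/- Schwarzschild-Anti-de Sitter background: basic operators on functions
   u(t, r, ϑ, φ) with values in ℂ. -/

noncomputable section

open Filter Topology Set

namespace Grav

abbrev F4 : Type := ℝ → ℝ → ℝ → ℝ → ℂ

/-- `Δ(r) = r² + k²r⁴ − 2Mr`. -/
def Del (M k r : ℝ) : ℝ := r ^ 2 + k ^ 2 * r ^ 4 - 2 * M * r

/-- `∂ₜ`. -/
def dT (u : F4) : F4 := fun t r ϑ φ => deriv (fun s => u s r ϑ φ) t
/-- `∂ᵣ`. -/
def dR (u : F4) : F4 := fun t r ϑ φ => deriv (fun s => u t s ϑ φ) r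
/-- `∂_ϑ`. -/
def dTh (u : F4) : F4 := fun t r ϑ φ => deriv (fun s => u t r s φ) ϑ
/-- `∂_φ`. -/
def dPh (u : F4) : F4 := fun t r ϑ φ => deriv (fun s => u t r ϑ s) φ

/-- `L u = ∂ₜ u + (Δ/r²) ∂ᵣ u`. -/
def opL (M k : ℝ) (u : F4) : F4 := fun t r ϑ φ =>
  dT u t r ϑ φ + ((Del M k r / r ^ 2 : ℝ) : ℂ) * dR u t r ϑ φ

/-- `L̲ u = ∂ₜ u − (Δ/r²) ∂ᵣ u`. -/
def opLb (M k : ℝ) (u : F4) : F4 := fun t r ϑ φ =>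
  dT u t r ϑ φ - ((Del M k r / r ^ 2 : ℝ) : ℂ) * dR u t r ϑ φ

/-- `w = Δ/r⁴`. -/
def ww (M k r : ℝ) : ℝ := Del M k r / r ^ 4
/-- `w′ = w·(6M − 2r)/r²`. -/
def wwP (M k r : ℝ) : ℝ := ww M k r * (6 * M - 2 * r) / r ^ 2

/-- The angular operator `𝓛⁽⁺²⁾`. -/
def angP (u : F4) : F4 := fun t r ϑ φ =>
  -(Real.sin ϑ : ℂ)⁻¹ * deriv (fun x => (Real.sin x : ℂ) * dTh u t r x φ) ϑ
  - (((Real.sin ϑ) ^ 2 : ℝ) : ℂ)⁻¹ * dPh (dPh u) t r ϑ φ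
  - 4 * Complex.I * ((Real.cos ϑ / (Real.sin ϑ) ^ 2 : ℝ) : ℂ) * dPh u t r ϑ φ
  + 4 * (((Real.cos ϑ / Real.sin ϑ) ^ 2 : ℝ) : ℂ) * u t r ϑ φ
  + 4 * u t r ϑ φ

/-- The angular operator `𝓛⁽⁻²⁾`. -/
def angM (u : F4) : F4 := fun t r ϑ φ =>
  -(Real.sin ϑ : ℂ)⁻¹ * deriv (fun x => (Real.sin x : ℂ) * dTh u t r x φ) ϑ
  - (((Real.sin ϑ) ^ 2 : ℝ) : ℂ)⁻¹ * dPh (dPh u) t r ϑ φ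
  + 4 * Complex.I * ((Real.cos ϑ / (Real.sin ϑ) ^ 2 : ℝ) : ℂ) * dPh u t r ϑ φ
  + 4 * (((Real.cos ϑ / Real.sin ϑ) ^ 2 : ℝ) : ℂ) * u t r ϑ φ
  + 4 * u t r ϑ φ

/-- The Teukolsky operator `𝔗⁽⁺²⁾u = −LL̲u + 2(w′/w)L̲u − w(𝓛⁽⁺²⁾ − 2 + 6M/r)u`. -/
def Tp (M k : ℝ) (u : F4) : F4 := fun t r ϑ φ =>
  - opL M k (opLb M k u) t r ϑ φ
  + 2 * ((wwP M k r / ww M k r : ℝ) : ℂ) * opLb M k u t r ϑ φ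
  - ((ww M k r : ℝ) : ℂ) *
      (angP u t r ϑ φ - 2 * u t r ϑ φ + ((6 * M / r : ℝ) : ℂ) * u t r ϑ φ)

/-- The Teukolsky operator `𝔗⁽⁻²⁾u = −LL̲u − 2(w′/w)Lu − w(𝓛⁽⁻²⁾ − 2 + 6M/r)u`. -/
def Tm (M k : ℝ) (u : F4) : F4 := fun t r ϑ φ =>
  - opL M k (opLb M k u) t r ϑ φ
  - 2 * ((wwP M k r / ww M k r : ℝ) : ℂ) * opL M k u t r ϑ φ
  - ((ww M k r : ℝ) : ℂ) *
      (angM u t r ϑ φ - 2 * u t r ϑ φ + ((6 * M / r : ℝ) : ℂ) * u t r ϑ φ)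

/-- The Regge–Wheeler operator `𝕽⁽⁺²⁾u = −LL̲u − w(𝓛⁽⁺²⁾ − 6M/r)u`. -/
def RWp (M k : ℝ) (u : F4) : F4 := fun t r ϑ φ =>
  - opL M k (opLb M k u) t r ϑ φ
  - ((ww M k r : ℝ) : ℂ) * (angP u t r ϑ φ - ((6 * M / r : ℝ) : ℂ) * u t r ϑ φ)

/-- The Regge–Wheeler operator `𝕽⁽⁻²⁾u = −LL̲u − w(𝓛⁽⁻²⁾ − 6M/r)u`. -/
def RWm (M k : ℝ) (u : F4) : F4 := fun t r ϑ φ =>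
  - opL M k (opLb M k u) t r ϑ φ
  - ((ww M k r : ℝ) : ℂ) * (angM u t r ϑ φ - ((6 * M / r : ℝ) : ℂ) * u t r ϑ φ)

/-- The exterior region `Ω = {r > r₊, 0 < ϑ < π}` (as a subset of ℝ⁴). -/
def OmSet (rp : ℝ) : Set (ℝ × ℝ × ℝ × ℝ) :=
  {p | rp < p.2.1 ∧ 0 < p.2.2.1 ∧ p.2.2.1 < Real.pi}

/-- `u` is smooth on `Ω`. -/
def SmoothOnOm (rp : ℝ) (u : F4) : Prop :=
  ContDiffOn ℝ (⊤ : ℕ∞)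
    (fun p : ℝ × ℝ × ℝ × ℝ => u p.1 p.2.1 p.2.2.1 p.2.2.2) (OmSet rp)

/-- Multiplication by `w⁻¹`. -/
def winv (M k : ℝ) (u : F4) : F4 := fun t r ϑ φ => ((ww M k r : ℝ) : ℂ)⁻¹ * u t r ϑ φ
/-- Multiplication by `w`. -/
def wmul (M k : ℝ) (u : F4) : F4 := fun t r ϑ φ => ((ww M k r : ℝ) : ℂ) * u t r ϑ φ
/-- Pointwise complex conjugation. -/
def conjF (u : F4) : F4 := fun t r ϑ φ => (starRingEnd ℂ) (u t r ϑ φ)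

/-- `𝓛⁽⁺²⁾(𝓛⁽⁺²⁾ − 2)`. -/
def angSqP (u : F4) : F4 := angP (fun t r ϑ φ => angP u t r ϑ φ - 2 * u t r ϑ φ)
/-- `𝓛⁽⁻²⁾(𝓛⁽⁻²⁾ − 2)`. -/
def angSqM (u : F4) : F4 := angM (fun t r ϑ φ => angM u t r ϑ φ - 2 * u t r ϑ φ)

/-- `𝓛⁽⁺²⁾(𝓛⁽⁺²⁾ − 2) + 12M∂ₜ`. -/
def TSp (M : ℝ) (u : F4) : F4 := fun t r ϑ φ =>
  angSqP u t r ϑ φ + 12 * (M : ℂ) * dT u t r ϑ φ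
/-- `𝓛⁽⁻²⁾(𝓛⁽⁻²⁾ − 2) − 12M∂ₜ`. -/
def TSm (M : ℝ) (u : F4) : F4 := fun t r ϑ φ =>
  angSqM u t r ϑ φ - 12 * (M : ℂ) * dT u t r ϑ φ

section SmoothAlgebra

variable {E : Type*} [NormedAddCommGroup E] [NormedSpace ℝ E]

/-- The algebra of smooth complex-valued functions on a set `U`. -/
def smoothAlg (U : Set E) : Subalgebra ℂ (U → ℂ) where
  carrier := {f | ∃ g : E → ℂ, ContDiffOn ℝ (⊤ : ℕ∞) g U ∧ ∀ p : U, f p = g p}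
  mul_mem' := by
    rintro f f' ⟨g, hg, hfg⟩ ⟨g', hg', hfg'⟩
    exact ⟨fun p => g p * g' p, hg.mul hg', fun p => by simp [hfg, hfg']⟩
  add_mem' := by
    rintro f f' ⟨g, hg, hfg⟩ ⟨g', hg', hfg'⟩
    exact ⟨fun p => g p + g' p, hg.add hg', fun p => by simp [hfg, hfg']⟩
  algebraMap_mem' c := ⟨fun _ => c, contDiffOn_const, fun _ => rfl⟩

variable {U : Set E}

/-- The element of `smoothAlg U` given by a function that is smooth on `U`. -/
def smoothAlg.mk (g : E → ℂ) (hg : ContDiffOn ℝ (⊤ : ℕ∞) g U) : smoothAlg U :=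
  ⟨fun p => g p, g, hg, fun _ => rfl⟩

@[simp]
lemma smoothAlg.mk_apply (g : E → ℂ) (hg : ContDiffOn ℝ (⊤ : ℕ∞) g U) (p : U) :
    (smoothAlg.mk g hg : U → ℂ) p = g p := rfl

@[simp]
lemma smoothAlg.ofNat_apply (n : ℕ) [n.AtLeastTwo] (p : U) :
    ((ofNat(n) : smoothAlg U) : U → ℂ) p = ofNat(n) := rfl

lemma smoothAlg.exists_eq_mk (a : smoothAlg U) : ∃ g hg, a = smoothAlg.mk g hg := by
  obtain ⟨f, g, hg, h⟩ := a
  exact ⟨g, hg, Subtype.ext (funext h)⟩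

/-- An extension of an element of `smoothAlg U` to the ambient space. -/
def smoothAlg.out (a : smoothAlg U) : E → ℂ := (smoothAlg.exists_eq_mk a).choose

lemma smoothAlg.contDiffOn_out (a : smoothAlg U) : ContDiffOn ℝ (⊤ : ℕ∞) (smoothAlg.out a) U :=
  (smoothAlg.exists_eq_mk a).choose_spec.choose

lemma smoothAlg.out_apply (a : smoothAlg U) {p : E} (hp : p ∈ U) :
    smoothAlg.out a p = (a : U → ℂ) ⟨p, hp⟩ :=
  (congrArg (fun b : smoothAlg U => (b : U → ℂ) ⟨p, hp⟩)
    (smoothAlg.exists_eq_mk a).choose_spec.choose_spec).symm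

lemma smoothAlg.hasFDerivAt_out (hU : IsOpen U) (a : smoothAlg U) {p : E} (hp : p ∈ U) :
    HasFDerivAt (smoothAlg.out a) (fderiv ℝ (smoothAlg.out a) p) p :=
  (((smoothAlg.contDiffOn_out a).contDiffAt (hU.mem_nhds hp)).differentiableAt
    (by simp)).hasFDerivAt

lemma contDiffOn_fderiv_apply (hU : IsOpen U) {g : E → ℂ} (hg : ContDiffOn ℝ (⊤ : ℕ∞) g U)
    (v : E) : ContDiffOn ℝ (⊤ : ℕ∞) (fun p => fderiv ℝ g p v) U :=
  (hg.fderiv_of_isOpen hU (by simp)).clm_apply contDiffOn_const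

lemma smoothAlg.fderiv_out_eq (hU : IsOpen U) (a : smoothAlg U) {g : E → ℂ}
    (h : ∀ p : U, (a : U → ℂ) p = g p) {p : E} (hp : p ∈ U) :
    fderiv ℝ (smoothAlg.out a) p = fderiv ℝ g p := by
  refine Filter.EventuallyEq.fderiv_eq ?_
  filter_upwards [hU.mem_nhds hp] with q hq
  rw [smoothAlg.out_apply a hq, h]

/-- The directional derivative along `v`, as a derivation of `smoothAlg U`. -/
def dirDeriv (hU : IsOpen U) (v : E) : Derivation ℂ (smoothAlg U) (smoothAlg U) :=
  Derivation.mk'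
    { toFun := fun a => smoothAlg.mk _ (contDiffOn_fderiv_apply hU (smoothAlg.contDiffOn_out a) v)
      map_add' := by
        intro a b
        ext ⟨p, hp⟩
        have h := smoothAlg.fderiv_out_eq hU (a + b)
          (g := fun q => smoothAlg.out a q + smoothAlg.out b q)
          (fun q => by simp [smoothAlg.out_apply _ q.2]) hp
        have h' := ((smoothAlg.hasFDerivAt_out hU a hp).add
          (smoothAlg.hasFDerivAt_out hU b hp)).fderiv
        change fderiv ℝ (fun q => smoothAlg.out a q + smoothAlg.out b q) p = _ at h'
        simp [h, h']
      map_smul' := by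
        intro c a
        ext ⟨p, hp⟩
        have h := smoothAlg.fderiv_out_eq hU (c • a) (g := fun q => c * smoothAlg.out a q)
          (fun q => by simp [smoothAlg.out_apply _ q.2]) hp
        have h' := ((smoothAlg.hasFDerivAt_out hU a hp).const_mul c).fderiv
        simp [h, h'] }
    (by
      intro a b
      ext ⟨p, hp⟩
      have h := smoothAlg.fderiv_out_eq hU (a * b)
        (g := fun q => smoothAlg.out a q * smoothAlg.out b q)
        (fun q => by simp [smoothAlg.out_apply _ q.2]) hp
      have h' := ((smoothAlg.hasFDerivAt_out hU a hp).mul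
        (smoothAlg.hasFDerivAt_out hU b hp)).fderiv
      change fderiv ℝ (fun q => smoothAlg.out a q * smoothAlg.out b q) p = _ at h'
      simp [h, h', smoothAlg.out_apply _ hp])

lemma dirDeriv_apply_eq (hU : IsOpen U) (v : E) (a : smoothAlg U) {g : E → ℂ}
    (h : ∀ p : U, (a : U → ℂ) p = g p) (p : U) :
    (dirDeriv hU v a : U → ℂ) p = fderiv ℝ g p v :=
  congrArg (fun T => T v) (smoothAlg.fderiv_out_eq hU a h p.2)

lemma dirDeriv_comm (hU : IsOpen U) (v v' : E) (a : smoothAlg U) :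
    dirDeriv hU v (dirDeriv hU v' a) = dirDeriv hU v' (dirDeriv hU v a) := by
  ext p
  rw [dirDeriv_apply_eq hU v _ (g := fun q => fderiv ℝ (smoothAlg.out a) q v') (fun _ => rfl),
    dirDeriv_apply_eq hU v' _ (g := fun q => fderiv ℝ (smoothAlg.out a) q v) (fun _ => rfl)]
  have hc := (smoothAlg.contDiffOn_out a).contDiffAt (hU.mem_nhds p.2)
  have hd : DifferentiableAt ℝ (fderiv ℝ (smoothAlg.out a)) p :=
    (((smoothAlg.contDiffOn_out a).fderiv_of_isOpen hU (m := (⊤ : ℕ∞)) (by simp)).contDiffAt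
      (hU.mem_nhds p.2)).differentiableAt (by simp)
  have hsm : minSmoothness ℝ 2 ≤ ((⊤ : ℕ∞) : WithTop ℕ∞) := by
    rw [minSmoothness_of_isRCLikeNormedField]
    exact WithTop.coe_le_coe.2 (le_top : (2 : ℕ∞) ≤ ⊤)
  have hs := (hc.isSymmSndFDerivAt hsm).eq v v'
  have key : ∀ z : E, fderiv ℝ (fun q => fderiv ℝ (smoothAlg.out a) q z) p
      = (fderiv ℝ (fderiv ℝ (smoothAlg.out a)) p).flip z := by
    intro z
    rw [fderiv_clm_apply hd (differentiableAt_const z)]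
    simp
  simpa [key] using hs

/-- The directional derivative computed along a curve with the given velocity. -/
lemma hasDerivAt_dirDeriv (hU : IsOpen U) (v : E) (a : smoothAlg U) {g : E → ℂ}
    (h : ∀ p : U, (a : U → ℂ) p = g p) {γ : ℝ → E} {x : ℝ} (hγ : HasDerivAt γ v x)
    (hx : γ x ∈ U) :
    HasDerivAt (fun s => g (γ s)) ((dirDeriv hU v a : U → ℂ) ⟨γ x, hx⟩) x := by
  have hg : HasFDerivAt g (fderiv ℝ (smoothAlg.out a) (γ x)) (γ x) := by
    refine (smoothAlg.hasFDerivAt_out hU a hx).congr_of_eventuallyEq ?_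
    filter_upwards [hU.mem_nhds hx] with q hq
    rw [smoothAlg.out_apply a hq, h]
  exact hg.comp_hasDerivAt x hγ

end SmoothAlgebra

/-- The algebraic content of the factorization: `X`, `Y` play the roles of the two null
derivatives, `v` is the inverse of `w`, and `q`, `h`, `m` are the radial functions
occurring in the Teukolsky operator. -/
lemma teukolsky_starobinsky_algebraic {A : Type*} [CommRing A] [Algebra ℂ A]
    (X Y : Derivation ℂ A A) (hXY : ∀ a, X (Y a) = Y (X a))
    (Λ : A →ₗ[ℂ] A) (hXΛ : ∀ a, X (Λ a) = Λ (X a)) (hYΛ : ∀ a, Y (Λ a) = Λ (Y a))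
    {w v q h m : A} (hwv : w * v = 1)
    (hΛw : ∀ a, Λ (w * a) = w * Λ a)
    (hΛq : ∀ a, Λ (q * a) = q * Λ a) (hΛh : ∀ a, Λ (h * a) = h * Λ a)
    (hXw : X w = q * w) (hXv : X v = -(q * v)) (hYq : Y q = w * (2 * h - 2))
    (hYh : Y h = m * w) (hXh : X h = -(m * w)) (hXm : X m = 0)
    (hmq : m * q = h * h - 2 * h) {a : A}
    (hT : X (Y a) = 2 * q * Y a - w * (Λ a - 2 * a + h * a)) :
    Λ (Λ a - 2 * a) - m * (X a + Y a) = w ^ 2 * (v * X (v * X (v * Y (v * Y a)))) := by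
  have two_mul_Λ : ∀ b, Λ (2 * b) = 2 * Λ b := fun b => by rw [two_mul, map_add, two_mul]
  have Y_two : ∀ b, Y (2 * b) = 2 * Y b := fun b => by rw [two_mul, map_add, two_mul]
  obtain ⟨b, hb⟩ : ∃ b, b = v * Y a := ⟨_, rfl⟩
  have hYa : Y a = w * b := by rw [hb]; linear_combination (-Y a) * hwv
  obtain ⟨c, hc⟩ : ∃ c, c = v * Y b := ⟨_, rfl⟩
  have hYb : Y b = w * c := by rw [hc]; linear_combination (-Y b) * hwv
  have hXb : X b = q * b - (Λ a - 2 * a + h * a) := by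
    rw [hb, X.leibniz, hT, hXv]
    simp only [smul_eq_mul]
    linear_combination (-(Λ a - 2 * a + h * a)) * hwv
  have hXc : X c = -(Λ b - h * b) - m * a := by
    have e : X (Y b) = Y (X b) := hXY b
    rw [hXb, hYb] at e
    simp only [map_sub, map_add, Derivation.leibniz, smul_eq_mul, hYΛ, hYa, hYb, hYq, hYh,
      hXw, hΛw, Y_two] at e
    linear_combination v * e + (h * b - Λ b - m * a - X c) * hwv
  rw [← hb, ← hc, hXc]
  simp only [map_sub, map_add, map_neg, Derivation.leibniz, smul_eq_mul, hXΛ, hXb, hXv,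
    hXh, hXm, two_mul_Λ, hΛh, hΛq, hYa]
  linear_combination (-a) * hmq - (w * v + 1) *
    (Λ (Λ a) - 2 * Λ a - m * (X a + w * b) + a * (m * q - h * h + 2 * h)) * hwv

/-- The angular operator with coefficients `c`, `z`, `y`, `x`, built from two derivations. -/
def angularMap {A : Type*} [CommRing A] [Algebra ℂ A] (dθ dφ : Derivation ℂ A A)
    (c z y x : A) : A →ₗ[ℂ] A where
  toFun a := -dθ (dθ a) - c * dθ a - z * dφ (dφ a) - y * dφ a + x * a
  map_add' a b := by simp only [map_add]; ring
  map_smul' s a := by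
    rw [Algebra.smul_def]
    simp only [Derivation.leibniz, Derivation.map_algebraMap, smul_eq_mul,
      mul_zero, add_zero, RingHom.id_apply, Algebra.smul_def s]
    ring

/-- A derivation commutes with an angular operator if it commutes with the two derivations
and kills the coefficients. -/
lemma derivation_angularMap {A : Type*} [CommRing A] [Algebra ℂ A]
    {dθ dφ X : Derivation ℂ A A} {c z y x : A}
    (hθ : ∀ a, X (dθ a) = dθ (X a)) (hφ : ∀ a, X (dφ a) = dφ (X a))
    (hc : X c = 0) (hz : X z = 0) (hy : X y = 0) (hx : X x = 0) (a : A) :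
    X (angularMap dθ dφ c z y x a) = angularMap dθ dφ c z y x (X a) := by
  simp [angularMap, hθ, hφ, hc, hz, hy, hx]

lemma angularMap_mul {A : Type*} [CommRing A] [Algebra ℂ A]
    {dθ dφ : Derivation ℂ A A} {c z y x g : A} (hθ : dθ g = 0) (hφ : dφ g = 0) (a : A) :
    angularMap dθ dφ c z y x (g * a) = g * angularMap dθ dφ c z y x a := by
  simp only [angularMap, LinearMap.coe_mk, AddHom.coe_mk, Derivation.leibniz, smul_eq_mul,
    hθ, hφ, mul_zero, add_zero]
  ring

lemma derivation_inverse {A : Type*} [CommRing A] [Algebra ℂ A] (X : Derivation ℂ A A)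
    {w v : A} (h : w * v = 1) : X v = -(v * v * X w) := by
  have e := congrArg X h
  simp only [Derivation.leibniz, Derivation.map_one_eq_zero, smul_eq_mul] at e
  linear_combination v * e - X v * h

/-- The factorization in coordinates: `r` is the radial coordinate with inverse `ρ`, `v` is the
inverse of `w = ρ² + K − 2Mρ³`, and `s = ±1` distinguishes the two spin weights. -/
lemma teukolsky_starobinsky_coordinates {A : Type*} [CommRing A] [Algebra ℂ A]
    {dt dr dθ dφ : Derivation ℂ A A}
    (htr : ∀ a, dt (dr a) = dr (dt a)) (htθ : ∀ a, dt (dθ a) = dθ (dt a))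
    (htφ : ∀ a, dt (dφ a) = dφ (dt a)) (hrθ : ∀ a, dr (dθ a) = dθ (dr a))
    (hrφ : ∀ a, dr (dφ a) = dφ (dr a))
    {c z y x : A} (htc : dt c = 0) (htz : dt z = 0) (hty : dt y = 0) (htx : dt x = 0)
    (hrc : dr c = 0) (hrz : dr z = 0) (hry : dr y = 0) (hrx : dr x = 0)
    {r ρ : A} (hρ : r * ρ = 1) (htr' : dt r = 0) (hrr : dr r = 1) (hθr : dθ r = 0)
    (hφr : dφ r = 0) (M K s : ℂ) (hs : s * s = 1) {w v G : A}
    (hw : w = ρ ^ 2 + algebraMap ℂ A K - 2 * algebraMap ℂ A M * ρ ^ 3) (hwv : w * v = 1)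
    (hG : G = r ^ 2 * w) {X Y : Derivation ℂ A A}
    (hX : X = dt + (algebraMap ℂ A s * G) • dr) (hY : Y = dt - (algebraMap ℂ A s * G) • dr)
    {Λ : A →ₗ[ℂ] A} (hΛ : Λ = angularMap dθ dφ c z y x) {a : A}
    (hT : X (Y a) = 2 * (algebraMap ℂ A s * (6 * algebraMap ℂ A M * ρ ^ 2 - 2 * ρ)) * Y a
      - w * (Λ a - 2 * a + 6 * algebraMap ℂ A M * ρ * a)) :
    Λ (Λ a - 2 * a) - 12 * algebraMap ℂ A M * algebraMap ℂ A s * dt a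
      = w ^ 2 * (v * X (v * X (v * Y (v * Y a)))) := by
  have Xa : ∀ b, X b = dt b + algebraMap ℂ A s * G * dr b := fun b => by simp [hX]
  have Ya : ∀ b, Y b = dt b - algebraMap ℂ A s * G * dr b := fun b => by simp [hY]
  have hs' : algebraMap ℂ A s * algebraMap ℂ A s = 1 := by rw [← map_mul, hs, map_one]
  have two : ∀ (D : Derivation ℂ A A), D 2 = 0 := fun D => by
    simpa using D.map_natCast 2
  have six : ∀ (D : Derivation ℂ A A), D 6 = 0 := fun D => by
    simpa using D.map_natCast 6
  generalize hm : algebraMap ℂ A M = m at *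
  generalize hσ : algebraMap ℂ A s = σ at *
  generalize hκ : algebraMap ℂ A K = κ at *
  have cm : ∀ (D : Derivation ℂ A A), D m = 0 := fun D => by simp [← hm]
  have cσ : ∀ (D : Derivation ℂ A A), D σ = 0 := fun D => by simp [← hσ]
  have cκ : ∀ (D : Derivation ℂ A A), D κ = 0 := fun D => by simp [← hκ]
  have dρ : ∀ (D : Derivation ℂ A A), D ρ = -(ρ * ρ * D r) := fun D =>
    derivation_inverse D hρ
  have dw : ∀ (D : Derivation ℂ A A), D w = (6 * m * ρ ^ 4 - 2 * ρ ^ 3) * D r := fun D => by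
    simp only [hw, map_add, map_sub, pow_succ, pow_zero, one_mul, Derivation.leibniz,
      smul_eq_mul, two, cm, cκ, dρ]
    ring
  have dG : ∀ (D : Derivation ℂ A A), D r = 0 → D G = 0 := fun D h => by
    simp [hG, pow_two, dw, h]
  have dv : ∀ (D : Derivation ℂ A A), D v = -(v * v * D w) := fun D =>
    derivation_inverse D hwv
  have Gρ : G * ρ ^ 2 = w := by
    rw [hG]; linear_combination w * (r * ρ + 1) * hρ
  have hXr : X r = σ * G := by rw [Xa, htr', hrr]; ring
  have hYr : Y r = -(σ * G) := by rw [Ya, htr', hrr]; ring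
  have key := teukolsky_starobinsky_algebraic X Y (Λ := Λ) (w := w) (v := v)
    (q := σ * (6 * m * ρ ^ 2 - 2 * ρ)) (h := 6 * m * ρ) (m := 6 * m * σ) (a := a)
    ?_ ?_ ?_ hwv ?_ ?_ ?_ ?_ ?_ ?_ ?_ ?_ ?_ ?_ hT
  · linear_combination key + 6 * m * σ * (Xa a + Ya a)
  · intro b
    simp only [Xa, Ya, map_add, map_sub, Derivation.leibniz, smul_eq_mul, cσ, htr,
      dG dt htr']
    ring
  · intro b
    rw [hΛ]
    refine derivation_angularMap ?_ ?_ ?_ ?_ ?_ ?_ b <;> intros <;>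
      simp [Xa, htθ, htφ, hrθ, hrφ, htc, htz, hty, htx, hrc, hrz, hry, hrx, cσ, dG dθ hθr,
        dG dφ hφr]
  · intro b
    rw [hΛ]
    refine derivation_angularMap ?_ ?_ ?_ ?_ ?_ ?_ b <;> intros <;>
      simp [Ya, htθ, htφ, hrθ, hrφ, htc, htz, hty, htx, hrc, hrz, hry, hrx, cσ, dG dθ hθr,
        dG dφ hφr]
  · intro b
    rw [hΛ]
    apply angularMap_mul <;> simp [dw, hθr, hφr]
  · intro b
    rw [hΛ]
    apply angularMap_mul <;> simp [cσ, cm, dρ, hθr, hφr, pow_two, two, six]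
  · intro b
    rw [hΛ]
    apply angularMap_mul <;> simp [cm, dρ, hθr, hφr, six]
  · rw [dw, hXr]
    linear_combination (6 * m * ρ ^ 2 - 2 * ρ) * σ * Gρ
  · rw [dv, dw, hXr]
    linear_combination (-(v * v * σ * (6 * m * ρ ^ 2 - 2 * ρ))) * Gρ
      - v * σ * (6 * m * ρ ^ 2 - 2 * ρ) * hwv
  · simp only [map_sub, pow_two, Derivation.leibniz, smul_eq_mul, two, six, cm, cσ, dρ, hYr]
    linear_combination (12 * m * ρ - 2) * (G * ρ ^ 2 * hs' + Gρ)
  · simp only [Derivation.leibniz, smul_eq_mul, six, cm, dρ, hYr]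
    linear_combination 6 * m * σ * Gρ
  · simp only [Derivation.leibniz, smul_eq_mul, six, cm, dρ, hXr]
    linear_combination (-6 * m * σ) * Gρ
  · simp [cm, cσ, six]
  · linear_combination (6 * m * (6 * m * ρ ^ 2 - 2 * ρ)) * hs'

lemma isOpen_OmSet (rp : ℝ) : IsOpen (OmSet rp) :=
  (isOpen_lt continuous_const (continuous_fst.comp continuous_snd)).and
    ((isOpen_lt continuous_const (continuous_fst.comp (continuous_snd.comp continuous_snd))).and
      (isOpen_lt (continuous_fst.comp (continuous_snd.comp continuous_snd)) continuous_const))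

/-- `u` agrees on `Ω` with the element `a` of the algebra of smooth functions on `Ω`. -/
def Represents {rp : ℝ} (u : F4) (a : smoothAlg (OmSet rp)) : Prop :=
  ∀ (t r ϑ φ : ℝ) (hp : (t, r, ϑ, φ) ∈ OmSet rp),
    u t r ϑ φ = (a : OmSet rp → ℂ) ⟨(t, r, ϑ, φ), hp⟩

/-- `∂ₜ` as a derivation of the algebra of smooth functions on `Ω`. -/
def derT (rp : ℝ) : Derivation ℂ (smoothAlg (OmSet rp)) (smoothAlg (OmSet rp)) :=
  dirDeriv (isOpen_OmSet rp) (1, 0, 0, 0)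
/-- `∂ᵣ` as a derivation of the algebra of smooth functions on `Ω`. -/
def derR (rp : ℝ) : Derivation ℂ (smoothAlg (OmSet rp)) (smoothAlg (OmSet rp)) :=
  dirDeriv (isOpen_OmSet rp) (0, 1, 0, 0)
/-- `∂_ϑ` as a derivation of the algebra of smooth functions on `Ω`. -/
def derTh (rp : ℝ) : Derivation ℂ (smoothAlg (OmSet rp)) (smoothAlg (OmSet rp)) :=
  dirDeriv (isOpen_OmSet rp) (0, 0, 1, 0)
/-- `∂_φ` as a derivation of the algebra of smooth functions on `Ω`. -/
def derPh (rp : ℝ) : Derivation ℂ (smoothAlg (OmSet rp)) (smoothAlg (OmSet rp)) :=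
  dirDeriv (isOpen_OmSet rp) (0, 0, 0, 1)

section Represents

variable {rp : ℝ} {u : F4} {a : smoothAlg (OmSet rp)}

lemma Represents.hasDerivAt (h : Represents u a) {v : ℝ × ℝ × ℝ × ℝ}
    {γ : ℝ → ℝ × ℝ × ℝ × ℝ} {x : ℝ} (hγ : HasDerivAt γ v x) (hx : γ x ∈ OmSet rp) :
    HasDerivAt (fun s => u (γ s).1 (γ s).2.1 (γ s).2.2.1 (γ s).2.2.2)
      ((dirDeriv (isOpen_OmSet rp) v a : OmSet rp → ℂ) ⟨γ x, hx⟩) x :=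
  hasDerivAt_dirDeriv (isOpen_OmSet rp) v a
    (g := fun p => u p.1 p.2.1 p.2.2.1 p.2.2.2) (fun p => (h _ _ _ _ p.2).symm) hγ hx

lemma Represents.dT (h : Represents u a) : Represents (dT u) (derT rp a) :=
  fun t r ϑ φ hp => (h.hasDerivAt (γ := fun s => (s, r, ϑ, φ))
    ((hasDerivAt_id t).prodMk ((hasDerivAt_const t r).prodMk
      ((hasDerivAt_const t ϑ).prodMk (hasDerivAt_const t φ)))) hp).deriv

lemma Represents.dR (h : Represents u a) : Represents (dR u) (derR rp a) :=
  fun t r ϑ φ hp => (h.hasDerivAt (γ := fun s => (t, s, ϑ, φ))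
    ((hasDerivAt_const r t).prodMk ((hasDerivAt_id r).prodMk
      ((hasDerivAt_const r ϑ).prodMk (hasDerivAt_const r φ)))) hp).deriv

lemma Represents.hasDerivAt_polar (h : Represents u a) {t r ϑ φ : ℝ}
    (hp : (t, r, ϑ, φ) ∈ OmSet rp) :
    HasDerivAt (fun s => u t r s φ) ((derTh rp a : OmSet rp → ℂ) ⟨(t, r, ϑ, φ), hp⟩) ϑ :=
  h.hasDerivAt (γ := fun s => (t, r, s, φ))
    ((hasDerivAt_const ϑ t).prodMk ((hasDerivAt_const ϑ r).prodMk
      ((hasDerivAt_id ϑ).prodMk (hasDerivAt_const ϑ φ)))) hp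

lemma Represents.dTh (h : Represents u a) : Represents (dTh u) (derTh rp a) :=
  fun _ _ _ _ hp => (h.hasDerivAt_polar hp).deriv

lemma Represents.dPh (h : Represents u a) : Represents (dPh u) (derPh rp a) :=
  fun t r ϑ φ hp => (h.hasDerivAt (γ := fun s => (t, r, ϑ, s))
    ((hasDerivAt_const φ t).prodMk ((hasDerivAt_const φ r).prodMk
      ((hasDerivAt_const φ ϑ).prodMk (hasDerivAt_id φ)))) hp).deriv

lemma Represents.unique {b : smoothAlg (OmSet rp)} (h : Represents u a)
    (h' : ∀ (t r ϑ φ : ℝ) (hp : (t, r, ϑ, φ) ∈ OmSet rp),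
      u t r ϑ φ = (b : OmSet rp → ℂ) ⟨(t, r, ϑ, φ), hp⟩) : a = b := by
  ext ⟨⟨t, r, ϑ, φ⟩, hp⟩
  rw [← h t r ϑ φ hp, h' t r ϑ φ hp]

end Represents

/-- A smooth function of `r` alone, as an element of the algebra. -/
def radial {rp : ℝ} (f : ℝ → ℝ) (hf : ContDiffOn ℝ (⊤ : ℕ∞) f (Ioi rp)) :
    smoothAlg (OmSet rp) :=
  smoothAlg.mk (fun p => (f p.2.1 : ℂ))
    (Complex.ofRealCLM.contDiff.comp_contDiffOn
      (hf.comp (t := Ioi rp) (f := fun p : ℝ × ℝ × ℝ × ℝ => p.2.1) (by fun_prop)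
        fun _ hp => hp.1))

/-- A smooth function of `ϑ` alone, as an element of the algebra. -/
def polar {rp : ℝ} (f : ℝ → ℂ) (hf : ContDiffOn ℝ (⊤ : ℕ∞) f (Ioo 0 Real.pi)) :
    smoothAlg (OmSet rp) :=
  smoothAlg.mk (fun p => f p.2.2.1)
    (hf.comp (t := Ioo 0 Real.pi) (f := fun p : ℝ × ℝ × ℝ × ℝ => p.2.2.1) (by fun_prop)
      fun _ hp => hp.2)

section Coefficients

variable {rp : ℝ}

@[simp]
lemma radial_apply (f : ℝ → ℝ) (hf : ContDiffOn ℝ (⊤ : ℕ∞) f (Ioi rp)) (p : OmSet rp) :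
    (radial f hf : OmSet rp → ℂ) p = f p.1.2.1 := rfl

@[simp]
lemma polar_apply (f : ℝ → ℂ) (hf : ContDiffOn ℝ (⊤ : ℕ∞) f (Ioo 0 Real.pi)) (p : OmSet rp) :
    ((polar f hf : smoothAlg (OmSet rp)) : OmSet rp → ℂ) p = f p.1.2.2.1 := rfl

lemma represents_radial (f : ℝ → ℝ) (hf : ContDiffOn ℝ (⊤ : ℕ∞) f (Ioi rp)) :
    Represents (fun _ r _ _ => (f r : ℂ)) (radial f hf) := fun _ _ _ _ _ => rfl

lemma represents_polar (f : ℝ → ℂ) (hf : ContDiffOn ℝ (⊤ : ℕ∞) f (Ioo 0 Real.pi)) :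
    Represents (rp := rp) (fun _ _ ϑ _ => f ϑ) (polar f hf) := fun _ _ _ _ _ => rfl

lemma derT_radial (f : ℝ → ℝ) (hf : ContDiffOn ℝ (⊤ : ℕ∞) f (Ioi rp)) :
    derT rp (radial f hf) = 0 :=
  (represents_radial f hf).dT.unique fun _ _ _ _ _ => by simp [dT]

lemma derTh_radial (f : ℝ → ℝ) (hf : ContDiffOn ℝ (⊤ : ℕ∞) f (Ioi rp)) :
    derTh rp (radial f hf) = 0 :=
  (represents_radial f hf).dTh.unique fun _ _ _ _ _ => by simp [dTh]

lemma derPh_radial (f : ℝ → ℝ) (hf : ContDiffOn ℝ (⊤ : ℕ∞) f (Ioi rp)) :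
    derPh rp (radial f hf) = 0 :=
  (represents_radial f hf).dPh.unique fun _ _ _ _ _ => by simp [dPh]

lemma derR_radial_id : derR rp (radial (fun r => r) contDiffOn_id) = 1 :=
  (represents_radial _ _).dR.unique fun _ r _ _ _ => by
    exact (Complex.ofRealCLM.hasDerivAt (x := r)).deriv

lemma derT_polar (f : ℝ → ℂ) (hf : ContDiffOn ℝ (⊤ : ℕ∞) f (Ioo 0 Real.pi)) :
    derT rp (polar f hf) = 0 :=
  (represents_polar f hf).dT.unique fun _ _ _ _ _ => by simp [dT]

lemma derR_polar (f : ℝ → ℂ) (hf : ContDiffOn ℝ (⊤ : ℕ∞) f (Ioo 0 Real.pi)) :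
    derR rp (polar f hf) = 0 :=
  (represents_polar f hf).dR.unique fun _ _ _ _ _ => by simp [dR]

end Coefficients

/-- The angular operators `𝓛⁽⁺²⁾` (`σ = 1`) and `𝓛⁽⁻²⁾` (`σ = -1`). -/
def ang (σ : ℂ) (u : F4) : F4 := fun t r ϑ φ =>
  -(Real.sin ϑ : ℂ)⁻¹ * deriv (fun x => (Real.sin x : ℂ) * dTh u t r x φ) ϑ
  - (((Real.sin ϑ) ^ 2 : ℝ) : ℂ)⁻¹ * dPh (dPh u) t r ϑ φ
  - σ * (4 * Complex.I * ((Real.cos ϑ / (Real.sin ϑ) ^ 2 : ℝ) : ℂ) * dPh u t r ϑ φ)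
  + 4 * (((Real.cos ϑ / Real.sin ϑ) ^ 2 : ℝ) : ℂ) * u t r ϑ φ
  + 4 * u t r ϑ φ

lemma contDiffOn_polar {f : ℝ → ℝ} (hf : ContDiffOn ℝ (⊤ : ℕ∞) f (Ioo 0 Real.pi)) :
    ContDiffOn ℝ (⊤ : ℕ∞) (fun ϑ => (f ϑ : ℂ)) (Ioo 0 Real.pi) :=
  Complex.ofRealCLM.contDiff.comp_contDiffOn hf

lemma contDiffOn_sin : ContDiffOn ℝ (⊤ : ℕ∞) Real.sin (Ioo 0 Real.pi) :=
  Real.contDiff_sin.contDiffOn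

lemma contDiffOn_cos : ContDiffOn ℝ (⊤ : ℕ∞) Real.cos (Ioo 0 Real.pi) :=
  Real.contDiff_cos.contDiffOn

lemma sin_ne_zero_of_mem {ϑ : ℝ} (h : ϑ ∈ Ioo 0 Real.pi) : Real.sin ϑ ≠ 0 :=
  (Real.sin_pos_of_mem_Ioo h).ne'

/-- The angular operators acting on the algebra of smooth functions on `Ω`. -/
def angAlg (rp : ℝ) (σ : ℂ) : smoothAlg (OmSet rp) →ₗ[ℂ] smoothAlg (OmSet rp) :=
  angularMap (derTh rp) (derPh rp)
    (polar _ (contDiffOn_polar (contDiffOn_cos.div contDiffOn_sin fun _ => sin_ne_zero_of_mem)))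
    (polar _ (contDiffOn_polar ((contDiffOn_sin.pow 2).inv
      fun _ h => pow_ne_zero 2 (sin_ne_zero_of_mem h))))
    (polar _ (contDiffOn_const (c := σ * (4 * Complex.I)) |>.mul <| contDiffOn_polar
      (contDiffOn_cos.div (contDiffOn_sin.pow 2)
        fun _ h => pow_ne_zero 2 (sin_ne_zero_of_mem h))))
    (polar _ (contDiffOn_polar ((contDiffOn_const (c := 4)).add ((contDiffOn_const (c := 4)).mul
      ((contDiffOn_cos.div contDiffOn_sin fun _ => sin_ne_zero_of_mem).pow 2)))))

lemma Represents.ang {rp : ℝ} {u : F4} {a : smoothAlg (OmSet rp)} (h : Represents u a) (σ : ℂ) :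
    Represents (ang σ u) (angAlg rp σ a) := by
  intro t r ϑ φ hp
  have hs : (Real.sin ϑ : ℂ) ≠ 0 := Complex.ofReal_ne_zero.2 (sin_ne_zero_of_mem hp.2)
  have e : deriv (fun x => (Real.sin x : ℂ) * Grav.dTh u t r x φ) ϑ
      = (Real.cos ϑ : ℂ) * Grav.dTh u t r ϑ φ
        + (Real.sin ϑ : ℂ) * Grav.dTh (Grav.dTh u) t r ϑ φ := by
    rw [h.dTh.dTh t r ϑ φ hp]
    exact ((Real.hasDerivAt_sin ϑ).ofReal_comp.mul (h.dTh.hasDerivAt_polar hp)).deriv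
  simp only [Grav.ang, e, h.dTh t r ϑ φ hp, h.dTh.dTh t r ϑ φ hp, h.dPh t r ϑ φ hp,
    h.dPh.dPh t r ϑ φ hp, h t r ϑ φ hp, angAlg, angularMap, LinearMap.coe_mk, AddHom.coe_mk]
  simp
  simp at hs
  field_simp
  ring

/-- The null derivatives `L` (`s = 1`) and `L̲` (`s = -1`). -/
def opNull (M k : ℝ) (s : ℂ) (u : F4) : F4 := fun t r ϑ φ =>
  dT u t r ϑ φ + s * ((Del M k r / r ^ 2 : ℝ) : ℂ) * dR u t r ϑ φ

lemma opL_eq_opNull (M k : ℝ) : opL M k = opNull M k 1 := by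
  funext u t r ϑ φ
  simp [opL, opNull]

lemma opLb_eq_opNull (M k : ℝ) : opLb M k = opNull M k (-1) := by
  funext u t r ϑ φ
  simp [opLb, opNull, sub_eq_add_neg]

lemma angP_eq_ang : angP = ang 1 := by
  funext u t r ϑ φ
  simp [angP, ang]

lemma angM_eq_ang : angM = ang (-1) := by
  funext u t r ϑ φ
  simp [angM, ang]

section Background

variable {M k rp : ℝ}

lemma ww_pos (hrp : 0 < rp) (hroot : rp + k ^ 2 * rp ^ 3 - 2 * M = 0) {r : ℝ} (hr : rp < r) :
    0 < ww M k r := by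
  have h0 : 0 < r := hrp.trans hr
  have h3 : k ^ 2 * rp ^ 3 ≤ k ^ 2 * r ^ 3 := by gcongr
  have : Del M k r = r * (r + k ^ 2 * r ^ 3 - 2 * M) := by rw [Del]; ring
  rw [ww, this]
  have : 0 < r + k ^ 2 * r ^ 3 - 2 * M := by linarith
  positivity

lemma ww_eq {r : ℝ} (hr : r ≠ 0) :
    ww M k r = r⁻¹ ^ 2 + k ^ 2 - 2 * M * r⁻¹ ^ 3 := by
  rw [ww, Del]
  field_simp

lemma contDiffOn_inv_Ioi (hrp : 0 < rp) :
    ContDiffOn ℝ (⊤ : ℕ∞) (fun r : ℝ => r⁻¹) (Ioi rp) :=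
  contDiffOn_id.inv fun _ h => (hrp.trans h).ne'

lemma contDiffOn_ww (hrp : 0 < rp) : ContDiffOn ℝ (⊤ : ℕ∞) (ww M k) (Ioi rp) := by
  have h := contDiffOn_inv_Ioi hrp
  refine ContDiffOn.congr (f := fun r => r⁻¹ ^ 2 + k ^ 2 - 2 * M * r⁻¹ ^ 3) ?_
    fun r hr => ww_eq (hrp.trans hr).ne'
  exact ((h.pow 2).add contDiffOn_const).sub (contDiffOn_const.mul (h.pow 3))

lemma contDiffOn_ww_inv (hrp : 0 < rp) (hroot : rp + k ^ 2 * rp ^ 3 - 2 * M = 0) :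
    ContDiffOn ℝ (⊤ : ℕ∞) (fun r => (ww M k r)⁻¹) (Ioi rp) :=
  (contDiffOn_ww hrp).inv fun _ h => (ww_pos hrp hroot h).ne'

/-- The radial coordinate as an element of the algebra. -/
def coordR (rp : ℝ) : smoothAlg (OmSet rp) := radial (fun r => r) contDiffOn_id

/-- The null derivatives as derivations of the algebra of smooth functions on `Ω`. -/
def derNull (M k : ℝ) (hrp : 0 < rp) (s : ℂ) :
    Derivation ℂ (smoothAlg (OmSet rp)) (smoothAlg (OmSet rp)) :=
  derT rp + (algebraMap ℂ (smoothAlg (OmSet rp)) s *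
    (coordR rp ^ 2 * radial (ww M k) (contDiffOn_ww hrp))) • derR rp

variable {u : F4} {a : smoothAlg (OmSet rp)}

lemma Represents.opNull (h : Represents u a) (hrp : 0 < rp) (s : ℂ) :
    Represents (opNull M k s u) (derNull M k hrp s a) := by
  intro t r ϑ φ hp
  have hr : (r : ℂ) ≠ 0 := Complex.ofReal_ne_zero.2 (hrp.trans hp.1).ne'
  simp only [Grav.opNull, h.dT t r ϑ φ hp, h.dR t r ϑ φ hp, derNull]
  simp only [coordR, Derivation.add_apply, Derivation.smul_apply, smul_eq_mul,
    Subalgebra.coe_add, Subalgebra.coe_mul, Subalgebra.coe_pow, Subalgebra.coe_algebraMap,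
    Pi.add_apply, Pi.mul_apply, Pi.pow_apply, Pi.algebraMap_apply, radial_apply, ww,
    Algebra.algebraMap_self, RingHom.id_apply, Complex.ofReal_div, Complex.ofReal_pow]
  field_simp

lemma Represents.winv (h : Represents u a) (hrp : 0 < rp)
    (hroot : rp + k ^ 2 * rp ^ 3 - 2 * M = 0) :
    Represents (winv M k u)
      (radial (fun r => (ww M k r)⁻¹) (contDiffOn_ww_inv hrp hroot) * a) := by
  intro t r ϑ φ hp
  simp [Grav.winv, h t r ϑ φ hp]

lemma Represents.sub_two_mul {u' : F4} {b : smoothAlg (OmSet rp)} (h : Represents u a)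
    (h' : Represents u' b) :
    Represents (fun t r ϑ φ => u t r ϑ φ - 2 * u' t r ϑ φ) (a - 2 * b) := by
  intro t r ϑ φ hp
  simp [h t r ϑ φ hp, h' t r ϑ φ hp]

lemma derNull_comm (M k : ℝ) (hrp : 0 < rp) (s s' : ℂ) (a : smoothAlg (OmSet rp)) :
    derNull M k hrp s (derNull M k hrp s' a) = derNull M k hrp s' (derNull M k hrp s a) := by
  have hG : derT rp (coordR rp ^ 2 * radial (ww M k) (contDiffOn_ww hrp)) = 0 := by
    simp [coordR, pow_two, derT_radial]
  have hc : ∀ b, derT rp (derR rp b) = derR rp (derT rp b) := dirDeriv_comm _ _ _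
  simp only [derNull, Derivation.add_apply, Derivation.smul_apply, smul_eq_mul, map_add,
    Derivation.leibniz _ (algebraMap ℂ (smoothAlg (OmSet rp)) _ * _),
    Derivation.leibniz _ (algebraMap ℂ (smoothAlg (OmSet rp)) _), Derivation.map_algebraMap,
    hG, hc]
  ring

lemma exists_represents (hu : SmoothOnOm rp u) :
    ∃ a : smoothAlg (OmSet rp), Represents u a :=
  ⟨smoothAlg.mk _ hu, fun _ _ _ _ _ => rfl⟩

lemma opNull_comm (M k : ℝ) (hrp : 0 < rp) (hu : SmoothOnOm rp u) (s s' : ℂ) {t r ϑ φ : ℝ}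
    (hp : (t, r, ϑ, φ) ∈ OmSet rp) :
    opNull M k s (opNull M k s' u) t r ϑ φ = opNull M k s' (opNull M k s u) t r ϑ φ := by
  obtain ⟨a, ha⟩ := exists_represents hu
  rw [(ha.opNull hrp s').opNull hrp s t r ϑ φ hp, (ha.opNull hrp s).opNull hrp s' t r ϑ φ hp,
    derNull_comm]

/-- The factorization for both spin weights: `s = 1` is `+2` and `s = -1` is `-2`. -/
lemma teukolsky_starobinsky (hrp : 0 < rp) (hroot : rp + k ^ 2 * rp ^ 3 - 2 * M = 0)
    {s : ℂ} (hs : s * s = 1) (hu : SmoothOnOm rp u)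
    (hT : ∀ t r ϑ φ : ℝ, (t, r, ϑ, φ) ∈ OmSet rp →
      - opNull M k s (opNull M k (-s) u) t r ϑ φ
      + s * (2 * ((wwP M k r / ww M k r : ℝ) : ℂ) * opNull M k (-s) u t r ϑ φ)
      - ((ww M k r : ℝ) : ℂ) *
        (ang s u t r ϑ φ - 2 * u t r ϑ φ + ((6 * M / r : ℝ) : ℂ) * u t r ϑ φ) = 0)
    {t r ϑ φ : ℝ} (hp : (t, r, ϑ, φ) ∈ OmSet rp) :
    ang s (fun t r ϑ φ => ang s u t r ϑ φ - 2 * u t r ϑ φ) t r ϑ φ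
        - s * (12 * (M : ℂ) * dT u t r ϑ φ) =
      (((ww M k r) ^ 2 : ℝ) : ℂ) *
        winv M k (opNull M k s (winv M k (opNull M k s
          (winv M k (opNull M k (-s) (winv M k (opNull M k (-s) u))))))) t r ϑ φ := by
  obtain ⟨a, ha⟩ := exists_represents hu
  set w := radial (rp := rp) (ww M k) (contDiffOn_ww hrp) with hw
  set v := radial (rp := rp) (fun r => (ww M k r)⁻¹) (contDiffOn_ww_inv hrp hroot) with hv
  set ρ := radial (rp := rp) (fun r => r⁻¹) (contDiffOn_inv_Ioi hrp) with hρ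
  have key := teukolsky_starobinsky_coordinates (dt := derT rp) (dr := derR rp)
    (dθ := derTh rp) (dφ := derPh rp) (dirDeriv_comm _ _ _) (dirDeriv_comm _ _ _)
    (dirDeriv_comm _ _ _) (dirDeriv_comm _ _ _) (dirDeriv_comm _ _ _)
    (derT_polar _ _) (derT_polar _ _) (derT_polar _ _) (derT_polar _ _)
    (derR_polar _ _) (derR_polar _ _) (derR_polar _ _) (derR_polar _ _)
    (r := coordR rp) (ρ := ρ) ?_
    (derT_radial _ _) derR_radial_id (derTh_radial _ _) (derPh_radial _ _)
    (M : ℂ) ((k : ℂ) ^ 2) s hs (w := w) (v := v) ?_ ?_ rfl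
    (X := derNull M k hrp s) (Y := derNull M k hrp (-s)) rfl ?_ (Λ := angAlg rp s) rfl
    (a := a) ?_
  · have e := congrArg (fun b : smoothAlg (OmSet rp) =>
      (b : OmSet rp → ℂ) ⟨(t, r, ϑ, φ), hp⟩) key
    rw [((ha.ang s).sub_two_mul ha).ang s t r ϑ φ hp, ha.dT t r ϑ φ hp,
      ((((((((ha.opNull hrp (-s)).winv hrp hroot).opNull hrp (-s)).winv hrp hroot).opNull
        hrp s).winv hrp hroot).opNull hrp s).winv hrp hroot) t r ϑ φ hp]
    simp only [Subalgebra.coe_sub, Subalgebra.coe_mul, Subalgebra.coe_pow,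
      Subalgebra.coe_algebraMap, Pi.sub_apply, Pi.mul_apply, Pi.pow_apply,
      Pi.algebraMap_apply, Algebra.algebraMap_self, RingHom.id_apply,
      smoothAlg.ofNat_apply] at e ⊢
    rw [hw, radial_apply] at e
    push_cast
    linear_combination e
  · ext ⟨⟨t, r, ϑ, φ⟩, hp⟩
    have hr : (r : ℂ) ≠ 0 := Complex.ofReal_ne_zero.2 (hrp.trans hp.1).ne'
    simp [coordR, hρ, hr]
  · ext ⟨⟨t, r, ϑ, φ⟩, hp⟩
    simp [hw, hρ, ww_eq (hrp.trans hp.1).ne']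
  · ext ⟨⟨t, r, ϑ, φ⟩, hp⟩
    have h : (ww M k r : ℂ) ≠ 0 := Complex.ofReal_ne_zero.2 (ww_pos hrp hroot hp.1).ne'
    simp [hw, hv, h]
  · refine Derivation.ext fun b => ?_
    simp only [derNull, Derivation.add_apply, Derivation.sub_apply, Derivation.smul_apply,
      smul_eq_mul, map_neg, hw]
    ring
  · ext ⟨⟨t, r, ϑ, φ⟩, hp⟩
    have e := hT t r ϑ φ hp
    have hr : r ≠ 0 := (hrp.trans hp.1).ne'
    have h : ww M k r ≠ 0 := (ww_pos hrp hroot hp.1).ne'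
    have hq : wwP M k r / ww M k r = 6 * M * r⁻¹ ^ 2 - 2 * r⁻¹ := by
      rw [wwP]
      field_simp
    rw [hq, (ha.opNull hrp (-s)).opNull hrp s t r ϑ φ hp, ha.opNull hrp (-s) t r ϑ φ hp,
      ha.ang s t r ϑ φ hp, ha t r ϑ φ hp] at e
    simp only [Subalgebra.coe_sub, Subalgebra.coe_add, Subalgebra.coe_mul, Subalgebra.coe_pow,
      Subalgebra.coe_algebraMap, Pi.sub_apply, Pi.add_apply, Pi.mul_apply, Pi.pow_apply,
      Pi.algebraMap_apply, Algebra.algebraMap_self, RingHom.id_apply,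
      smoothAlg.ofNat_apply, hw, hρ, radial_apply]
    push_cast at e ⊢
    linear_combination -e

end Background

/-- Composition of the Chandrasekhar transformations on solutions of
the Teukolsky equations gives the Teukolsky–Starobinsky operators:
`(𝓛⁽⁺²⁾(𝓛⁽⁺²⁾−2) − 12M∂ₜ)α̃ = w²(w⁻¹L)²(w⁻¹L̲)²α̃` if `𝔗⁽⁺²⁾α̃ = 0`, and
`(𝓛⁽⁻²⁾(𝓛⁽⁻²⁾−2) + 12M∂ₜ)α̃ = w²(w⁻¹L̲)²(w⁻¹L)²α̃` if `𝔗⁽⁻²⁾α̃ = 0`. -/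
theorem statement8
    (M k rp : ℝ) (hM : 0 < M) (hk : 0 < k) (hrp : 0 < rp)
    (hroot : rp + k ^ 2 * rp ^ 3 - 2 * M = 0) :
    (∀ α : F4, SmoothOnOm rp α →
      (∀ t r ϑ φ : ℝ, (t, r, ϑ, φ) ∈ OmSet rp → Tp M k α t r ϑ φ = 0) →
      ∀ t r ϑ φ : ℝ, (t, r, ϑ, φ) ∈ OmSet rp →
        angSqP α t r ϑ φ - 12 * (M : ℂ) * dT α t r ϑ φ =
          (((ww M k r) ^ 2 : ℝ) : ℂ) *
            winv M k (opL M k (winv M k (opL M k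
              (winv M k (opLb M k (winv M k (opLb M k α))))))) t r ϑ φ)
    ∧
    (∀ α : F4, SmoothOnOm rp α →
      (∀ t r ϑ φ : ℝ, (t, r, ϑ, φ) ∈ OmSet rp → Tm M k α t r ϑ φ = 0) →
      ∀ t r ϑ φ : ℝ, (t, r, ϑ, φ) ∈ OmSet rp →
        angSqM α t r ϑ φ + 12 * (M : ℂ) * dT α t r ϑ φ =
          (((ww M k r) ^ 2 : ℝ) : ℂ) *
            winv M k (opLb M k (winv M k (opLb M k
              (winv M k (opL M k (winv M k (opL M k α))))))) t r ϑ φ) := by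
  constructor
  · intro α hα hT t r ϑ φ hp
    have h := teukolsky_starobinsky (s := 1) hrp hroot (by ring) hα (fun t r ϑ φ hp => by
      have e := hT t r ϑ φ hp
      rw [Tp, opL_eq_opNull, opLb_eq_opNull, angP_eq_ang] at e
      linear_combination e) hp
    rw [angSqP, opL_eq_opNull, opLb_eq_opNull, angP_eq_ang]
    linear_combination h
  · intro α hα hT t r ϑ φ hp
    have h := teukolsky_starobinsky (s := -1) hrp hroot (by ring) hα (fun t r ϑ φ hp => by
      have e := hT t r ϑ φ hp
      rw [Tm, opL_eq_opNull, opLb_eq_opNull, angM_eq_ang,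
        opNull_comm M k hrp hα 1 (-1) hp] at e
      rw [neg_neg]
      linear_combination e) hp
    rw [neg_neg] at h
    rw [angSqM, opL_eq_opNull, opLb_eq_opNull, angM_eq_ang]
    linear_combination h

end Grav
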